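/- arXiv:1107.3954 — 4 statements merged into one kernel-verified Lean document; each statement's English description precedes it below -/
import Mathlib

section
/- Let G be a group and φ : G ≃* G a group automorphism. Let E be the HNN extension of G with both associated subgroups equal to all of G and associated isomorphism φ, i.e. E is generated by G together with a stable letter t subject to the relations t·g·t⁻¹ = φ(g) for all g ∈ G. Then the quotient of E by the normal closure of {t} is isomorphic to the quotient of G by the normal closure of the set {φ(g)·g⁻¹ : g ∈ G}. -/
namespace HNNExtension

variable {G : Type*} [Group G] {A B : Subgroup G} {φ : A ≃* B}

theorem mk_t_eq_one :
    QuotientGroup.mk' (Subgroup.normalClosure {(t : HNNExtension G A B φ)}) t = 1 :=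
  (QuotientGroup.eq_one_iff _).2 (Subgroup.subset_normalClosure (Set.mem_singleton _))

/-- The map from an HNN extension of `G` along `φ` to the quotient of `G` by the relations
`φ a = a` that sends the stable letter to `1`. -/
def toQuotient :
    HNNExtension G A B φ →*
      G ⧸ Subgroup.normalClosure (Set.range fun a : A => (φ a : G) * (a : G)⁻¹) :=
  lift (QuotientGroup.mk' _) 1 fun a => by
    rw [one_mul, mul_one, eq_comm, ← mul_inv_eq_one, ← map_inv, ← map_mul]
    exact (QuotientGroup.eq_one_iff _).2 (Subgroup.subset_normalClosure ⟨a, rfl⟩)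

@[simp]
theorem toQuotient_t : toQuotient (t : HNNExtension G A B φ) = 1 :=
  lift_t _ _ _

@[simp]
theorem toQuotient_of (g : G) : toQuotient (of g : HNNExtension G A B φ) = g :=
  lift_of _ _ _ _

theorem normalClosure_t_le_ker_toQuotient :
    Subgroup.normalClosure {(t : HNNExtension G A B φ)} ≤ toQuotient.ker :=
  Subgroup.normalClosure_le_normal
    (Set.singleton_subset_iff.2 (MonoidHom.mem_ker.2 toQuotient_t))

theorem normalClosure_le_ker_mk_comp_of :
    Subgroup.normalClosure (Set.range fun a : A => (φ a : G) * (a : G)⁻¹) ≤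
      ((QuotientGroup.mk' (Subgroup.normalClosure {(t : HNNExtension G A B φ)})).comp of).ker := by
  refine Subgroup.normalClosure_le_normal ?_
  rintro _ ⟨a, rfl⟩
  rw [SetLike.mem_coe, MonoidHom.mem_ker, MonoidHom.comp_apply, map_mul, equiv_eq_conj, map_mul,
    map_mul, map_mul, map_inv, map_inv, map_inv, mk_t_eq_one, one_mul, inv_one, mul_one,
    mul_inv_cancel]

/-- Killing the stable letter of an HNN extension of `G` along `φ : A ≃* B` gives the quotient of
`G` by the relations `φ a = a` for `a ∈ A`. -/
def quotientNormalClosureTEquiv :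
    (HNNExtension G A B φ ⧸ Subgroup.normalClosure {(t : HNNExtension G A B φ)}) ≃*
      G ⧸ Subgroup.normalClosure (Set.range fun a : A => (φ a : G) * (a : G)⁻¹) :=
  MonoidHom.toMulEquiv
    (QuotientGroup.lift _ toQuotient normalClosure_t_le_ker_toQuotient)
    (QuotientGroup.lift _ ((QuotientGroup.mk' _).comp of) normalClosure_le_ker_mk_comp_of)
    (by
      refine QuotientGroup.monoidHom_ext _ (hom_ext ?_ ?_)
      · ext g
        simp
      · simpa using mk_t_eq_one.symm)
    (by
      ext g
      simp)

end HNNExtension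

/-- For a group `G` and an automorphism `φ : G ≃* G`, the HNN extension of `G`
with both associated subgroups equal to all of `G` and associated isomorphism `φ` (so the
stable letter `t` satisfies `t·g·t⁻¹ = φ g` for all `g ∈ G`), quotiented by the normal
closure of `{t}`, is isomorphic to `G` quotiented by the normal closure of
`{φ g * g⁻¹ : g ∈ G}`. -/
theorem hnn_quotient_kill_stable_letter (G : Type*) [Group G] (φ : G ≃* G) :
    Nonempty
      ((HNNExtension G ⊤ ⊤
          ((Subgroup.topEquiv).trans (φ.trans Subgroup.topEquiv.symm)) ⧸
        Subgroup.normalClosure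
          {(HNNExtension.t :
            HNNExtension G ⊤ ⊤ ((Subgroup.topEquiv).trans (φ.trans Subgroup.topEquiv.symm)))})
        ≃*
      (G ⧸ Subgroup.normalClosure (Set.range fun g : G => φ g * g⁻¹))) := by
  exact ⟨HNNExtension.quotientNormalClosureTEquiv.trans
    (QuotientGroup.quotientMulEquivOfEq (congrArg Subgroup.normalClosure
      (Subgroup.topEquiv.surjective.range_comp fun g : G => φ g * g⁻¹)))⟩
end

section
/- Fix natural numbers g and r. Let ρ : FreeGroup (Fin g ⊕ Fin g) →* FreeGroup (Fin g) be the unique group homomorphism sending the generator indexed by inl k to the generator indexed by k and the generator indexed by inr k to the inverse of the generator indexed by k. Let w : Fin r → FreeGroup (Fin g) and suppose v : Fin r → FreeGroup (Fin g ⊕ Fin g) satisfies ρ(v i) = w i for every i. Then the presented group with generating set Fin g ⊕ Fin g and relator set {v i : i ∈ Fin r} ∪ {x_k · y_k : k ∈ Fin g} is isomorphic to the presented group with generating set Fin g and relator set {w i : i ∈ Fin r}. -/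
/-- The unique group homomorphism `FreeGroup (Fin g ⊕ Fin g) →* FreeGroup (Fin g)` sending
the generator indexed by `inl k` to the `k`-th generator and the generator indexed by
`inr k` to the inverse of the `k`-th generator. -/
def rho (g : ℕ) : FreeGroup (Fin g ⊕ Fin g) →* FreeGroup (Fin g) :=
  FreeGroup.lift (Sum.elim (fun k => FreeGroup.of k) (fun k => (FreeGroup.of k)⁻¹))

theorem lift_sumElim_of_inv_eq_mk_comp_rho (g : ℕ) (T : Set (FreeGroup (Fin g))) :
    FreeGroup.lift (Sum.elim (fun k => PresentedGroup.of k) (fun k => (PresentedGroup.of k)⁻¹)) =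
      (PresentedGroup.mk T).comp (rho g) := by
  ext x
  rcases x with k | k <;> simp [rho, PresentedGroup.of]

/-- If the relators include all the words `x_k · y_k`, then replacing every `y_k` by `x_k⁻¹`
does not change the class of a word. -/
theorem lift_of_inl_comp_rho (g : ℕ) {S : Set (FreeGroup (Fin g ⊕ Fin g))}
    (hS : ∀ k : Fin g, FreeGroup.of (Sum.inl k) * FreeGroup.of (Sum.inr k) ∈ S) :
    (FreeGroup.lift fun k => PresentedGroup.of (Sum.inl k)).comp (rho g) =
      PresentedGroup.mk S := by
  ext x
  rcases x with k | k
  · simp [rho, PresentedGroup.of]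
  · have h := PresentedGroup.one_of_mem (hS k)
    rw [map_mul] at h
    simpa [rho, PresentedGroup.of] using inv_eq_of_mul_eq_one_right h

/-- If `ρ (v i) = w i` for all `i`, then the presented group on generators
`Fin g ⊕ Fin g` with relators the `v i` together with the words `x_k · y_k`
(`x_k = of (inl k)`, `y_k = of (inr k)`) is isomorphic to the presented group on
generators `Fin g` with relators the `w i`. -/
theorem presented_group_double_generators (g r : ℕ)
    (w : Fin r → FreeGroup (Fin g)) (v : Fin r → FreeGroup (Fin g ⊕ Fin g))
    (hv : ∀ i, rho g (v i) = w i) :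
    Nonempty
      (PresentedGroup
          (Set.range v ∪
            Set.range (fun k : Fin g =>
              FreeGroup.of (Sum.inl k) * FreeGroup.of (Sum.inr k)))
        ≃* PresentedGroup (Set.range w)) := by
  set S := Set.range v ∪ Set.range (fun k : Fin g =>
    FreeGroup.of (Sum.inl k) * FreeGroup.of (Sum.inr k))
  have hxy : ∀ k : Fin g, FreeGroup.of (Sum.inl k) * FreeGroup.of (Sum.inr k) ∈ S :=
    fun k => Or.inr ⟨k, rfl⟩
  have hto : ∀ s ∈ S, FreeGroup.lift (Sum.elim (fun k => PresentedGroup.of k)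
      (fun k => (PresentedGroup.of (rels := Set.range w) k)⁻¹)) s = 1 := by
    rintro s (⟨i, rfl⟩ | ⟨k, rfl⟩)
    · rw [lift_sumElim_of_inv_eq_mk_comp_rho, MonoidHom.comp_apply, hv]
      exact PresentedGroup.one_of_mem ⟨i, rfl⟩
    · simp
  have hinv : ∀ t ∈ Set.range w,
      FreeGroup.lift (fun k => PresentedGroup.of (rels := S) (Sum.inl k)) t = 1 := by
    rintro t ⟨i, rfl⟩
    rw [← hv, ← MonoidHom.comp_apply, lift_of_inl_comp_rho g hxy]
    exact PresentedGroup.one_of_mem (Or.inl ⟨i, rfl⟩)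
  refine ⟨MonoidHom.toMulEquiv (PresentedGroup.toGroup hto) (PresentedGroup.toGroup hinv) ?_ ?_⟩
  · ext x
    rcases x with k | k
    · simp
    · have h := PresentedGroup.one_of_mem (hxy k)
      rw [map_mul] at h
      have hinvk : (PresentedGroup.of (rels := S) (Sum.inl k))⁻¹ = PresentedGroup.of (Sum.inr k) :=
        inv_eq_of_mul_eq_one_right h
      simpa using hinvk
  · ext k
    simp
end

section
/- Call an element of a free group a positive word if it lies in the submonoid generated by the generators (i.e. it is a product of generators with no inverses occurring). For every g, r ∈ ℕ and every family of relators w : Fin r → FreeGroup (Fin g), there exists a family v : Fin (r + g) → FreeGroup (Fin g ⊕ Fin g) such that every v j is a positive word and the presented group with generating set Fin g ⊕ Fin g and relator set {v j : j ∈ Fin (r+g)} is isomorphic to the presented group with generating set Fin g and relator set {w i : i ∈ Fin r}. In particular, every group admitting a finite presentation with g generators and r relators admits a finite presentation with 2g generators and r + g relators in which every relator is a positive word. -/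
namespace FreeGroup

/-- The homomorphism `FreeGroup (α ⊕ α) →* FreeGroup α` sending the generators of the second copy
of `α` to the inverses of the corresponding generators. -/
def foldInv (α : Type*) : FreeGroup (α ⊕ α) →* FreeGroup α :=
  lift (Sum.elim of fun a => (of a)⁻¹)

@[simp]
theorem foldInv_of_inl {α : Type*} (a : α) : foldInv α (of (.inl a)) = of a := by
  simp [foldInv]

@[simp]
theorem foldInv_of_inr {α : Type*} (a : α) : foldInv α (of (.inr a)) = (of a)⁻¹ := by
  simp [foldInv]

/-- Every element of `FreeGroup α` is the image under `foldInv` of a positive word. -/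
theorem exists_positive_foldInv_eq {α : Type*} (x : FreeGroup α) :
    ∃ p ∈ Submonoid.closure (Set.range (of : α ⊕ α → FreeGroup (α ⊕ α))), foldInv α p = x := by
  induction x using FreeGroup.induction_on with
  | C1 => exact ⟨1, one_mem _, _root_.map_one _⟩
  | of a => exact ⟨_, Submonoid.subset_closure ⟨.inl a, rfl⟩, foldInv_of_inl a⟩
  | inv_of a _ => exact ⟨_, Submonoid.subset_closure ⟨.inr a, rfl⟩, foldInv_of_inr a⟩
  | mul x y hx hy =>
    obtain ⟨p, hp, rfl⟩ := hx
    obtain ⟨q, hq, rfl⟩ := hy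
    exact ⟨p * q, mul_mem hp hq, _root_.map_mul _ _ _⟩

/-- A homomorphism sending the two copies of each generator to mutually inverse elements factors
through `foldInv`. -/
theorem lift_foldInv {α G : Type*} [Group G] (φ : FreeGroup (α ⊕ α) →* G)
    (h : ∀ a, φ (of (.inl a) * of (.inr a)) = 1) (x : FreeGroup (α ⊕ α)) :
    lift (fun a => φ (of (.inl a))) (foldInv α x) = φ x := by
  suffices (lift fun a => φ (of (.inl a))).comp (foldInv α) = φ from DFunLike.congr_fun this x
  ext (a | a)
  · simp
  · simpa using inv_eq_of_mul_eq_one_right ((_root_.map_mul φ _ _).symm.trans (h a))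

end FreeGroup

namespace PresentedGroup

/-- Adjoining a formal inverse to each generator does not change the presented group. -/
theorem nonempty_mulEquiv_of_foldInv {α : Type*} {S : Set (FreeGroup (α ⊕ α))}
    {R : Set (FreeGroup α)} (hS : ∀ s ∈ S, mk R (FreeGroup.foldInv α s) = 1)
    (hR : R ⊆ FreeGroup.foldInv α '' S)
    (hinv : ∀ a, FreeGroup.of (.inl a) * FreeGroup.of (.inr a) ∈ S) :
    Nonempty (PresentedGroup S ≃* PresentedGroup R) := by
  have key := FreeGroup.lift_foldInv (mk S) fun a => one_of_mem (hinv a)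
  have lift_eq : FreeGroup.lift (fun i => mk R (FreeGroup.foldInv α (FreeGroup.of i))) =
      (mk R).comp (FreeGroup.foldInv α) := by
    ext; simp
  have hf : ∀ s ∈ S, FreeGroup.lift
      (fun i => mk R (FreeGroup.foldInv α (FreeGroup.of i))) s = 1 := fun s hs => by
    rw [lift_eq]
    exact hS s hs
  have hg : ∀ x ∈ R, FreeGroup.lift (fun a => mk S (FreeGroup.of (.inl a))) x = 1 := fun x hx => by
    obtain ⟨s, hs, rfl⟩ := hR hx
    rw [key, one_of_mem hs]
  have hg_mk : ∀ x, toGroup hg (mk R x) =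
      FreeGroup.lift (fun a => mk S (FreeGroup.of (.inl a))) x := fun _ => rfl
  refine ⟨MonoidHom.toMulEquiv (toGroup hf) (toGroup hg) ?_ ?_⟩
  · ext i
    rw [MonoidHom.comp_apply, toGroup.of, hg_mk, key]
    rfl
  · ext a
    rw [MonoidHom.comp_apply, toGroup.of]
    exact (toGroup.of hf).trans (by rw [FreeGroup.foldInv_of_inl]; rfl)

end PresentedGroup


/-- Every group presented with `g` generators and `r` relators admits a
presentation with `2g` generators (indexed by `Fin g ⊕ Fin g`) and `r + g` relators in
which every relator is a *positive word*, i.e. lies in the submonoid generated by the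
generators (no inverses occur). -/
theorem exists_positive_presentation (g r : ℕ) (w : Fin r → FreeGroup (Fin g)) :
    ∃ v : Fin (r + g) → FreeGroup (Fin g ⊕ Fin g),
      (∀ j, v j ∈ Submonoid.closure
          (Set.range (FreeGroup.of : (Fin g ⊕ Fin g) → FreeGroup (Fin g ⊕ Fin g)))) ∧
      Nonempty (PresentedGroup (Set.range v) ≃* PresentedGroup (Set.range w)) := by
  choose p hp hpw using fun i => FreeGroup.exists_positive_foldInv_eq (w i)
  refine ⟨Fin.append p fun a => FreeGroup.of (.inl a) * FreeGroup.of (.inr a), fun j => ?_,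
    PresentedGroup.nonempty_mulEquiv_of_foldInv ?_ ?_ fun a => ⟨Fin.natAdd r a, by simp⟩⟩
  · refine Fin.addCases (fun i => ?_) (fun a => ?_) j
    · simpa using hp i
    · rw [Fin.append_right]
      exact mul_mem (Submonoid.subset_closure ⟨_, rfl⟩) (Submonoid.subset_closure ⟨_, rfl⟩)
  · rintro _ ⟨j, rfl⟩
    refine Fin.addCases (fun i => ?_) (fun a => ?_) j
    · rw [Fin.append_left, hpw]
      exact PresentedGroup.one_of_mem ⟨i, rfl⟩
    · simp
  · rintro _ ⟨i, rfl⟩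
    exact ⟨p i, ⟨Fin.castAdd g i, by simp⟩, hpw i⟩
end

section
/- Let P be any group. Let C = ℤ⁴ with standard basis c₁, c₂, c₃, c₄. Let φ : C →* P × (ℤ × ℤ) be the group homomorphism determined by φ(c₁) = 1, φ(c₂) = 1, φ(c₃) = (1, (1, 0)), φ(c₄) = (1, (0, 1)), and let ψ : C →* ℤ × ℤ be the group homomorphism determined by ψ(c₁) = (1, 0), ψ(c₂) = (0, 1), ψ(c₃) = 0, ψ(c₄) = 0. Then the pushout of φ and ψ in the category of groups is isomorphic to P, and the composition of the inclusion P → P × (ℤ × ℤ) with the canonical map to the pushout is an isomorphism onto it. -/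
/-- The standard basis elements `c₁, c₂, c₃, c₄` of `C = ℤ⁴` (written multiplicatively). -/
def stdBasis (i : Fin 4) : Multiplicative (Fin 4 → ℤ) :=
  Multiplicative.ofAdd (Pi.single i 1)

/-- The canonical map to the pushout identifies `inl (φ c)` with `inr (ψ c)`. -/
theorem pushout_mk_inl_eq_mk_inr {C A B : Type*} [Group C] [Group A] [Group B]
    (φ : C →* A) (ψ : C →* B) (c : C) :
    QuotientGroup.mk' (Subgroup.normalClosure
        (Set.range fun c : C =>
          Monoid.Coprod.inl (φ c) * (Monoid.Coprod.inr (ψ c) : Monoid.Coprod A B)⁻¹))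
      (Monoid.Coprod.inl (φ c)) =
    QuotientGroup.mk' (Subgroup.normalClosure
        (Set.range fun c : C =>
          Monoid.Coprod.inl (φ c) * (Monoid.Coprod.inr (ψ c) : Monoid.Coprod A B)⁻¹))
      (Monoid.Coprod.inr (ψ c)) := by
  rw [← mul_inv_eq_one, ← map_inv, ← map_mul]
  exact (QuotientGroup.eq_one_iff _).2 (Subgroup.subset_normalClosure ⟨c, rfl⟩)

/-- If `φ` has trivial `P`-component and `(φ, ψ)` maps onto `A × 1` and `1 × B`, then `P` maps
isomorphically onto the pushout of `φ : C →* P × A` and `ψ : C →* B`. -/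
theorem bijective_inl_pushout_of_factors_killed {C P A B : Type*} [Group C] [Group P] [Group A]
    [Group B] (φ : C →* P × A) (ψ : C →* B) (hP : ∀ c, (φ c).1 = 1)
    (hA : ∀ a, ∃ c, φ c = (1, a) ∧ ψ c = 1) (hB : ∀ b, ∃ c, φ c = 1 ∧ ψ c = b) :
    Function.Bijective
      ((QuotientGroup.mk' (Subgroup.normalClosure
        (Set.range fun c : C =>
          Monoid.Coprod.inl (φ c) *
            (Monoid.Coprod.inr (ψ c) : Monoid.Coprod (P × A) B)⁻¹))).comp
        ((Monoid.Coprod.inl).comp (MonoidHom.inl P A))) := by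
  have key := pushout_mk_inl_eq_mk_inr φ ψ
  set N := Subgroup.normalClosure
    (Set.range fun c : C =>
      Monoid.Coprod.inl (φ c) * (Monoid.Coprod.inr (ψ c) : Monoid.Coprod (P × A) B)⁻¹)
  let r : Monoid.Coprod (P × A) B →* P := Monoid.Coprod.lift (MonoidHom.fst P A) 1
  constructor
  · have hr : N ≤ r.ker := by
      refine Subgroup.normalClosure_le_normal ?_
      rintro _ ⟨c, rfl⟩
      simp [r, MonoidHom.mem_ker, hP]
    refine Function.LeftInverse.injective (g := QuotientGroup.lift N r hr) fun p => ?_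
    simp [r]
  · have hfactor : (((QuotientGroup.mk' N).comp
        ((Monoid.Coprod.inl).comp (MonoidHom.inl P A))).comp r) = QuotientGroup.mk' N := by
      refine Monoid.Coprod.hom_ext (MonoidHom.ext fun ⟨p, a⟩ => ?_) (MonoidHom.ext fun b => ?_)
      · obtain ⟨c, hφ, hψ⟩ := hA a
        have h := key c
        rw [hφ, hψ, map_one, map_one] at h
        have hpa : ((p, a) : P × A) = (p, 1) * (1, a) := by simp
        simp only [MonoidHom.comp_apply]
        rw [hpa, map_mul Monoid.Coprod.inl, map_mul (QuotientGroup.mk' N), h]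
        simp [r]
      · obtain ⟨c, hφ, hψ⟩ := hB b
        have h := key c
        rw [hφ, hψ, map_one, map_one] at h
        simp only [MonoidHom.comp_apply]
        have hrb : r (Monoid.Coprod.inr b) = 1 := by simp [r]
        rw [← h, hrb]
        simp only [map_one]
    intro x
    obtain ⟨y, rfl⟩ := QuotientGroup.mk'_surjective N x
    exact ⟨r y, DFunLike.congr_fun hfactor y⟩

theorem eq_stdBasis_zpow_mul (c : Multiplicative (Fin 4 → ℤ)) :
    c = stdBasis 0 ^ (c.toAdd 0) * stdBasis 1 ^ (c.toAdd 1) * stdBasis 2 ^ (c.toAdd 2) *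
      stdBasis 3 ^ (c.toAdd 3) := by
  apply Multiplicative.toAdd.injective
  funext i
  fin_cases i <;> simp [stdBasis]

theorem ofAdd_one_zero_zpow_mul (v : Multiplicative (ℤ × ℤ)) :
    Multiplicative.ofAdd ((1 : ℤ), (0 : ℤ)) ^ v.toAdd.1 *
      Multiplicative.ofAdd ((0 : ℤ), (1 : ℤ)) ^ v.toAdd.2 = v := by
  apply Multiplicative.toAdd.injective
  ext <;> simp

/-- Let `C = ℤ⁴` with standard basis `c₁, c₂, c₃, c₄`, and let
`φ : C →* P × ℤ²` and `ψ : C →* ℤ²` be the group homomorphisms determined by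
`φ(c₁) = φ(c₂) = 1`, `φ(c₃) = (1,(1,0))`, `φ(c₄) = (1,(0,1))` and
`ψ(c₁) = (1,0)`, `ψ(c₂) = (0,1)`, `ψ(c₃) = ψ(c₄) = 0`.  Then the pushout of `φ` and `ψ`
(the quotient of the free product `(P × ℤ²) ∗ ℤ²` by the normal closure of
`{φ(c)·ψ(c)⁻¹ : c ∈ C}`) is isomorphic to `P`; indeed the composition of the inclusion
`P → P × ℤ²` with the canonical map to the pushout is an isomorphism onto the pushout. -/
theorem pushout_kills_torus_factors (P : Type*) [Group P]
    (φ : Multiplicative (Fin 4 → ℤ) →* P × Multiplicative (ℤ × ℤ))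
    (ψ : Multiplicative (Fin 4 → ℤ) →* Multiplicative (ℤ × ℤ))
    (hφ1 : φ (stdBasis 0) = 1) (hφ2 : φ (stdBasis 1) = 1)
    (hφ3 : φ (stdBasis 2) = (1, Multiplicative.ofAdd ((1 : ℤ), (0 : ℤ))))
    (hφ4 : φ (stdBasis 3) = (1, Multiplicative.ofAdd ((0 : ℤ), (1 : ℤ))))
    (hψ1 : ψ (stdBasis 0) = Multiplicative.ofAdd ((1 : ℤ), (0 : ℤ)))
    (hψ2 : ψ (stdBasis 1) = Multiplicative.ofAdd ((0 : ℤ), (1 : ℤ)))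
    (hψ3 : ψ (stdBasis 2) = 1) (hψ4 : ψ (stdBasis 3) = 1) :
    Function.Bijective
      ((QuotientGroup.mk'
          (Subgroup.normalClosure
            (Set.range fun c : Multiplicative (Fin 4 → ℤ) =>
              Monoid.Coprod.inl (φ c) *
                (Monoid.Coprod.inr (ψ c) :
                  Monoid.Coprod (P × Multiplicative (ℤ × ℤ))
                    (Multiplicative (ℤ × ℤ)))⁻¹))).comp
        ((Monoid.Coprod.inl).comp (MonoidHom.inl P (Multiplicative (ℤ × ℤ))))) := by
  refine bijective_inl_pushout_of_factors_killed φ ψ (fun c => ?_) (fun v => ?_) (fun v => ?_)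
  · rw [eq_stdBasis_zpow_mul c]
    simp [hφ1, hφ2, hφ3, hφ4]
  · refine ⟨stdBasis 2 ^ v.toAdd.1 * stdBasis 3 ^ v.toAdd.2, ?_, ?_⟩
    · rw [map_mul, map_zpow, map_zpow, hφ3, hφ4]
      exact Prod.ext (by simp) (ofAdd_one_zero_zpow_mul v)
    · simp [hψ3, hψ4]
  · refine ⟨stdBasis 0 ^ v.toAdd.1 * stdBasis 1 ^ v.toAdd.2, by simp [hφ1, hφ2], ?_⟩
    rw [map_mul, map_zpow, map_zpow, hψ1, hψ2]
    exact ofAdd_one_zero_zpow_mul v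
end
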